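/- Let μ > 0, let δ > 0, let γ be a one-particle density matrix with density ρ, and define Ω := {x ∈ Λ : ρ(x) < δ}. Then Tr{(-Δ - μ·Id)γ} ≥ Tr{[P_Ω^⊥(-Δ - μ·Id)P_Ω^⊥]_-} - 4d·δ^{1/2}·|∂Ω| - μ·Σ_{x∈Ω} ρ(x). -/

import Mathlib

open Matrix
open scoped BigOperators Classical ComplexOrder

noncomputable section

/-- The discrete torus `Λ = (ℤ/Lℤ)^d`. -/
abbrev Lam (d L : ℕ) : Type := Fin d → ZMod L

/-- `x` and `y` are nearest neighbors on the torus (ℓ¹-distance 1). -/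
def isNN {d L : ℕ} (x y : Lam d L) : Prop :=
  ∃ ν : Fin d, (x ν = y ν + 1 ∨ x ν + 1 = y ν) ∧ ∀ μ : Fin d, μ ≠ ν → x μ = y μ

/-- The discrete Laplacian `Δ = T - 2d·Id` on the torus. -/
def lap (d L : ℕ) : Matrix (Lam d L) (Lam d L) ℂ :=
  (Matrix.of fun x y => if isNN x y then (1 : ℂ) else 0) - (2 * (d : ℂ)) • 1

/-- A one-particle density matrix: hermitian with `0 ≤ γ ≤ 1` as quadratic forms. -/
def IsDM {d L : ℕ} [NeZero L] (γ : Matrix (Lam d L) (Lam d L) ℂ) : Prop :=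
  γ.PosSemidef ∧ (1 - γ).PosSemidef

/-- `Tr{[X]_-}`: the sum of the negative eigenvalues of a hermitian matrix `X`
(junk value `0` if `X` is not hermitian). -/
def negTrace {n : Type} [Fintype n] [DecidableEq n] (X : Matrix n n ℂ) : ℝ :=
  if hX : X.IsHermitian then ∑ i, min (hX.eigenvalues i) 0 else 0

/-- The HFz energy functional. -/
def hfzE {d L : ℕ} [NeZero L] (μ U : ℝ) (γu γd : Matrix (Lam d L) (Lam d L) ℂ) : ℝ :=
  (((-(lap d L) - (μ : ℂ) • 1) * (γu + γd)).trace).re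
    + U * ∑ x, (γu x x).re * (γd x x).re

/-- The set of HFz energy values over pairs of one-particle density matrices. -/
def hfzEnergies (d L : ℕ) [NeZero L] (μ U : ℝ) : Set ℝ :=
  { E | ∃ γu γd : Matrix (Lam d L) (Lam d L) ℂ, IsDM γu ∧ IsDM γd ∧ hfzE μ U γu γd = E }

/-- The diagonal orthogonal projection `P_A` onto the coordinates in `A`. -/
def proj {d L : ℕ} (A : Set (Lam d L)) : Matrix (Lam d L) (Lam d L) ℂ :=
  Matrix.diagonal fun x => if x ∈ A then 1 else 0

/-- The boundary `∂Ω := {x ∈ Ω : x has a nearest neighbor outside Ω}`. -/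
def bdry {d L : ℕ} (Ω : Set (Lam d L)) : Set (Lam d L) :=
  {x | x ∈ Ω ∧ ∃ y, y ∉ Ω ∧ isNN x y}

open scoped MatrixOrder in
/-- The trace of a product of two positive semidefinite matrices is nonnegative. -/
lemma trace_mul_re_nonneg {n : Type} [Fintype n] {A B : Matrix n n ℂ}
    (hA : A.PosSemidef) (hB : B.PosSemidef) : 0 ≤ (A * B).trace.re := by
  obtain ⟨C, rfl⟩ := CStarAlgebra.nonneg_iff_eq_star_mul_self.mp hA.nonneg
  have h := (hB.mul_mul_conjTranspose_same C).trace_nonneg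
  rw [Matrix.trace_mul_comm, ← Matrix.mul_assoc] at h
  exact (Complex.le_def.mp h).1

/-- Variational principle: `negTrace X` bounds `Tr (X γ)` from below for `0 ≤ γ ≤ 1`. -/
lemma negTrace_le {n : Type} [Fintype n] [DecidableEq n] {X γ : Matrix n n ℂ}
    (hX : X.IsHermitian) (h0 : γ.PosSemidef) (h1 : (1 - γ).PosSemidef) :
    negTrace X ≤ (X * γ).trace.re := by
  let U : Matrix n n ℂ := hX.eigenvectorUnitary
  have hUU : Uᴴ * U = 1 := Unitary.coe_star_mul_self hX.eigenvectorUnitary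
  have hG0 : (Uᴴ * γ * U).PosSemidef := h0.conjTranspose_mul_mul_same U
  have hG1 : (1 - Uᴴ * γ * U).PosSemidef := by
    have h := h1.conjTranspose_mul_mul_same U
    rwa [Matrix.mul_sub, Matrix.sub_mul, Matrix.mul_one, hUU] at h
  have hspec : X = U * diagonal (fun i => (hX.eigenvalues i : ℂ)) * Uᴴ := by
    conv_lhs => rw [hX.spectral_theorem, Unitary.conjStarAlgAut_apply]
    rfl
  have htr : (X * γ).trace.re = ∑ i, hX.eigenvalues i * ((Uᴴ * γ * U) i i).re := by
    conv_lhs => rw [hspec]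
    rw [Matrix.mul_assoc, Matrix.mul_assoc, Matrix.trace_mul_comm, Matrix.mul_assoc,
      Matrix.trace, Complex.re_sum]
    refine Finset.sum_congr rfl fun i _ => ?_
    simp [Matrix.diagonal_mul]
  rw [negTrace, dif_pos hX, htr]
  refine Finset.sum_le_sum fun i _ => ?_
  have a0 : 0 ≤ ((Uᴴ * γ * U) i i).re := (Complex.le_def.mp (hG0.diag_nonneg (i := i))).1
  have a1 : ((Uᴴ * γ * U) i i).re ≤ 1 := by
    have h := (Complex.le_def.mp (hG1.diag_nonneg (i := i))).1
    rw [Matrix.sub_apply, Matrix.one_apply_eq] at h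
    simpa using h
  rcases le_total (hX.eigenvalues i) 0 with h | h
  · rw [min_eq_left h]; nlinarith
  · rw [min_eq_right h]; positivity

/-- Cauchy-Schwarz for the entries of a positive semidefinite matrix. -/
lemma norm_sq_apply_le {n : Type} [Fintype n] {γ : Matrix n n ℂ} (h : γ.PosSemidef) (x y : n) :
    ‖γ x y‖ ^ 2 ≤ (γ x x).re * (γ y y).re := by
  have hdet := (Complex.le_def.mp (h.submatrix ![x, y]).det_nonneg).1
  have hyx : γ y x = star (γ x y) := (h.1.apply y x).symm
  have hxx : (γ x x).im = 0 := (Complex.le_def.mp (h.diag_nonneg (i := x))).2.symm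
  rw [Matrix.det_fin_two] at hdet
  simp only [Matrix.submatrix_apply, Matrix.cons_val_zero, Matrix.cons_val_one, hyx] at hdet
  rw [← Complex.normSq_eq_norm_sq, Complex.normSq_apply]
  simp [Complex.mul_re, hxx] at hdet
  linarith

lemma apply_re_le_one {d L : ℕ} [NeZero L] {γ : Matrix (Lam d L) (Lam d L) ℂ} (h : IsDM γ)
    (x : Lam d L) : (γ x x).re ≤ 1 := by
  have h := (Complex.le_def.mp (h.2.diag_nonneg (i := x))).1
  rw [Matrix.sub_apply, Matrix.one_apply_eq] at h
  simpa using h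

lemma isNN_comm {d L : ℕ} {x y : Lam d L} : isNN x y ↔ isNN y x := by
  constructor <;>
  · rintro ⟨ν, h, h'⟩
    exact ⟨ν, h.symm.imp Eq.symm Eq.symm, fun μ hμ => (h' μ hμ).symm⟩

lemma not_isNN_self {d L : ℕ} (hL : 2 ≤ L) (x : Lam d L) : ¬ isNN x x := by
  have : Fact (1 < L) := ⟨hL⟩
  rintro ⟨ν, h, -⟩
  rcases h with h | h <;> simp at h

/-- Every site has at most `2d` nearest neighbors. -/
lemma card_isNN_le {d L : ℕ} [NeZero L] (x : Lam d L) :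
    (Finset.univ.filter fun y => isNN x y).card ≤ 2 * d := by
  have hsub : (Finset.univ.filter fun y => isNN x y) ⊆
      (Finset.univ : Finset (Fin d × Bool)).image
        (fun p => Function.update x p.1 (if p.2 then x p.1 + 1 else x p.1 - 1)) := by
    intro y hy
    obtain ⟨ν, h, h'⟩ := (Finset.mem_filter.mp hy).2
    rw [Finset.mem_image]
    have key : ∀ c, y ν = c → Function.update x ν c = y := by
      rintro c rfl
      funext μ
      by_cases hμ : μ = ν
      · subst hμ; simp
      · rw [Function.update_of_ne hμ, h' μ hμ]
    rcases h with h | h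
    · exact ⟨(ν, false), Finset.mem_univ _, key _ (by simp [h])⟩
    · exact ⟨(ν, true), Finset.mem_univ _, key _ (by simp [h])⟩
  refine (Finset.card_le_card hsub).trans (Finset.card_image_le.trans ?_)
  simp [mul_comm]

lemma neg_lap_apply_of_ne {d L : ℕ} {x y : Lam d L} (h : x ≠ y) :
    (-(lap d L)) x y = if isNN x y then -1 else 0 := by
  simp only [lap, Matrix.neg_apply, Matrix.sub_apply, Matrix.smul_apply, Matrix.one_apply_ne h,
    Matrix.of_apply]
  split_ifs <;> simp

lemma neg_lap_apply_self {d L : ℕ} (hL : 2 ≤ L) (x : Lam d L) :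
    (-(lap d L)) x x = 2 * d := by
  simp [lap, not_isNN_self hL]

lemma isHermitian_neg_lap {d L : ℕ} : (-(lap d L)).IsHermitian := by
  refine Matrix.IsHermitian.ext fun x y => ?_
  rcases eq_or_ne x y with rfl | h
  · simp only [lap, Matrix.neg_apply, Matrix.sub_apply, Matrix.smul_apply, Matrix.one_apply_eq,
      Matrix.of_apply]
    split_ifs <;> simp
  · rw [neg_lap_apply_of_ne h, neg_lap_apply_of_ne h.symm, isNN_comm]
    split_ifs <;> simp

/-- `-Δ ≥ 0`. -/
lemma posSemidef_neg_lap {d L : ℕ} [NeZero L] (hL : 2 ≤ L) : (-(lap d L)).PosSemidef := by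
  have hH := isHermitian_neg_lap (d := d) (L := L)
  rw [hH.posSemidef_iff_eigenvalues_nonneg]
  intro i
  have hev : Module.End.HasEigenvalue (Matrix.toLin' (-(lap d L))) (hH.eigenvalues i : ℂ) := by
    refine Module.End.hasEigenvalue_of_hasEigenvector
      (x := ((hH.eigenvectorBasis i).ofLp : Lam d L → ℂ)) ⟨?_, ?_⟩
    · rw [Module.End.mem_eigenspace_iff, Matrix.toLin'_apply, hH.mulVec_eigenvectorBasis]
      rfl
    · exact (WithLp.ofLp_eq_zero 2).ne.2 (hH.eigenvectorBasis.orthonormal.ne_zero i)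
  obtain ⟨k, hk⟩ := eigenvalue_mem_ball hev
  rw [mem_closedBall_iff_norm, neg_lap_apply_self hL] at hk
  have hsum : ∑ j ∈ Finset.univ.erase k, ‖(-(lap d L)) k j‖ ≤ 2 * d := by
    calc ∑ j ∈ Finset.univ.erase k, ‖(-(lap d L)) k j‖
        ≤ ∑ j ∈ Finset.univ.erase k, (if isNN k j then (1 : ℝ) else 0) := by
          refine Finset.sum_le_sum fun j hj => ?_
          rw [neg_lap_apply_of_ne (Finset.ne_of_mem_erase hj).symm]
          split_ifs <;> simp
      _ ≤ ∑ j, (if isNN k j then (1 : ℝ) else 0) :=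
          Finset.sum_le_sum_of_subset_of_nonneg (Finset.subset_univ _)
            fun j _ _ => by split_ifs <;> simp
      _ = (Finset.univ.filter fun y => isNN k y).card := by simp
      _ ≤ 2 * d := by exact_mod_cast card_isNN_le k
  have hre : |hH.eigenvalues i - 2 * d| ≤ 2 * d := by
    refine le_trans ?_ (hk.trans hsum)
    rw [← Real.norm_eq_abs, ← Complex.norm_real]
    simp
  have := (abs_le.mp hre).1
  simpa using this

lemma proj_isHermitian {d L : ℕ} (A : Set (Lam d L)) : (proj A)ᴴ = proj A := by
  rw [proj, Matrix.diagonal_conjTranspose]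
  congr 1
  funext x
  simp only [Pi.star_apply]
  split_ifs <;> simp

lemma proj_mul_mul_proj_apply {d L : ℕ} [NeZero L] (A B : Set (Lam d L))
    (M : Matrix (Lam d L) (Lam d L) ℂ) (x y : Lam d L) :
    (proj A * M * proj B) x y = if x ∈ A ∧ y ∈ B then M x y else 0 := by
  rw [proj, proj, Matrix.mul_diagonal, Matrix.diagonal_mul]
  split_ifs <;> simp_all

/-- Splitting of `-Δ - μ` into its blocks with respect to `Ω` and its complement. -/
lemma kinetic_block_decomposition {d L : ℕ} [NeZero L] (μ : ℂ) (Ω : Set (Lam d L)) :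
    -(lap d L) - μ • 1 = proj Ωᶜ * (-(lap d L) - μ • 1) * proj Ωᶜ
      + proj Ω * (-(lap d L)) * proj Ω - μ • proj Ω
      + (proj Ω * (-(lap d L)) * proj Ωᶜ + proj Ωᶜ * (-(lap d L)) * proj Ω) := by
  ext x y
  simp only [Matrix.add_apply, Matrix.sub_apply, Matrix.smul_apply, proj_mul_mul_proj_apply]
  rcases eq_or_ne x y with rfl | h
  · by_cases hx : x ∈ Ω <;> simp [proj, hx]
  · by_cases hx : x ∈ Ω <;> by_cases hy : y ∈ Ω <;> simp [proj, hx, hy, h]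

/-- The hopping between `Ω` and its complement costs at most `4 d √δ |∂Ω|`. -/
lemma hopping_lower_bound {d L : ℕ} [NeZero L] {δ : ℝ} (hδ : 0 < δ)
    {γ : Matrix (Lam d L) (Lam d L) ℂ} (hγ : IsDM γ) {Ω : Set (Lam d L)}
    (hΩ : ∀ x ∈ Ω, (γ x x).re ≤ δ) :
    -(4 * d * Real.sqrt δ * (bdry Ω).ncard) ≤
      ((proj Ω * (-(lap d L)) * proj Ωᶜ + proj Ωᶜ * (-(lap d L)) * proj Ω) * γ).trace.re := by
  set R := proj Ω * (-(lap d L)) * proj Ωᶜ + proj Ωᶜ * (-(lap d L)) * proj Ω with hR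
  set b : Lam d L → Lam d L → ℝ := fun x y => if x ∈ bdry Ω ∧ isNN x y then 1 else 0 with hb
  have hb0 : ∀ x y, 0 ≤ b x y := fun x y => by simp only [hb]; split_ifs <;> simp
  have hγle : ∀ x y, x ∈ Ω → ‖γ x y‖ ≤ Real.sqrt δ := fun x y hx => by
    refine Real.le_sqrt_of_sq_le ((norm_sq_apply_le hγ.1 x y).trans ?_)
    have hy0 := (Complex.le_def.mp (hγ.1.diag_nonneg (i := y))).1
    have hy1 := apply_re_le_one hγ y
    have := hΩ x hx
    simp only [Complex.zero_re] at hy0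
    nlinarith
  have hγsymm : ∀ x y, ‖γ x y‖ = ‖γ y x‖ := fun x y => by
    rw [← hγ.1.1.apply x y, norm_star]
  have hblock : ∀ x y, x ∈ Ω → y ∉ Ω →
      ‖(if isNN x y then (-1 : ℂ) else 0)‖ ≤ b x y := fun x y hx hy => by
    by_cases hn : isNN x y
    · have : x ∈ bdry Ω := ⟨hx, y, hy, hn⟩
      simp [hb, hn, this]
    · simp [hb, hn]
  have hentry : ∀ x y, -((b x y + b y x) * Real.sqrt δ) ≤ (R x y * γ y x).re := fun x y => by
    have hn : ‖R x y * γ y x‖ ≤ (b x y + b y x) * Real.sqrt δ := by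
      have hs := Real.sqrt_nonneg δ
      rw [norm_mul]
      simp only [hR, Matrix.add_apply, proj_mul_mul_proj_apply, Set.mem_compl_iff]
      by_cases hx : x ∈ Ω <;> by_cases hy : y ∈ Ω
      · have := mul_nonneg (add_nonneg (hb0 x y) (hb0 y x)) hs
        simpa [hx, hy] using this
      · have hne : x ≠ y := fun h => hy (h ▸ hx)
        simp only [hx, hy, not_true_eq_false, not_false_eq_true, and_self, if_true, if_false,
          add_zero, neg_lap_apply_of_ne hne]
        exact mul_le_mul ((hblock x y hx hy).trans (by linarith [hb0 y x]))
          ((hγsymm y x).trans_le (hγle x y hx)) (norm_nonneg _) (add_nonneg (hb0 _ _) (hb0 _ _))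
      · have hne : x ≠ y := fun h => hx (h ▸ hy)
        simp only [hx, hy, not_true_eq_false, not_false_eq_true, and_self, if_true, if_false,
          zero_add, neg_lap_apply_of_ne hne, isNN_comm (x := x)]
        exact mul_le_mul ((hblock y x hy hx).trans (by linarith [hb0 x y]))
          (hγle y x hy) (norm_nonneg _) (add_nonneg (hb0 _ _) (hb0 _ _))
      · have := mul_nonneg (add_nonneg (hb0 x y) (hb0 y x)) hs
        simpa [hx, hy] using this
    exact (abs_le.mp ((Complex.abs_re_le_norm _).trans hn)).1
  have hbsum : ∑ x, ∑ y, b x y ≤ 2 * d * (bdry Ω).ncard := by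
    have hrow : ∀ x, ∑ y, b x y ≤ if x ∈ bdry Ω then 2 * (d : ℝ) else 0 := fun x => by
      by_cases hx : x ∈ bdry Ω
      · simp only [hb, hx, true_and, if_true, Finset.sum_boole]
        exact_mod_cast card_isNN_le x
      · simp [hb, hx]
    refine (Finset.sum_le_sum fun x _ => hrow x).trans_eq ?_
    rw [← Finset.sum_filter, Finset.sum_const, nsmul_eq_mul, mul_comm,
      Set.ncard_eq_toFinset_card']
    congr 3
    ext x
    simp
  have htr : (R * γ).trace.re = ∑ x, ∑ y, (R x y * γ y x).re := by
    simp [Matrix.trace, Matrix.mul_apply]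
  rw [htr]
  refine le_trans ?_ (Finset.sum_le_sum fun x _ => Finset.sum_le_sum fun y _ => hentry x y)
  have hcomm : ∑ x, ∑ y, b y x = ∑ x, ∑ y, b x y := Finset.sum_comm
  simp only [Finset.sum_neg_distrib, ← Finset.sum_mul, Finset.sum_add_distrib, hcomm]
  nlinarith [Real.sqrt_nonneg δ, mul_le_mul_of_nonneg_right hbsum (Real.sqrt_nonneg δ)]

/-- Lemma 3.1, kinetic energy in the high density region: for a
one-particle density matrix `γ` with density `ρ` and `Ω = {ρ < δ}`,
`Tr{(-Δ-μ)γ} ≥ Tr{[P_Ω^⊥(-Δ-μ)P_Ω^⊥]_-} - 4d δ^{1/2} |∂Ω| - μ Σ_{x∈Ω} ρ(x)`. -/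
theorem kinetic_energy_lower_bound (d L : ℕ) (hd : 1 ≤ d) [NeZero L]
    (hLeven : Even L) (hL2 : 2 ≤ L) (μ : ℝ) (hμ : 0 < μ) (δ : ℝ) (hδ : 0 < δ)
    (γ : Matrix (Lam d L) (Lam d L) ℂ) (hγ : IsDM γ)
    (Ω : Set (Lam d L)) (hΩ : Ω = {x | (γ x x).re < δ}) :
    negTrace (proj Ωᶜ * (-(lap d L) - (μ : ℂ) • 1) * proj Ωᶜ)
        - 4 * d * Real.sqrt δ * (bdry Ω).ncard
        - μ * ∑ x ∈ Finset.univ.filter (fun x => x ∈ Ω), (γ x x).re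
      ≤ (((-(lap d L) - (μ : ℂ) • 1) * γ).trace).re := by
  have hle : ∀ x ∈ Ω, (γ x x).re ≤ δ := fun x hx => by
    rw [hΩ] at hx
    exact le_of_lt hx
  have hX : (proj Ωᶜ * (-(lap d L) - (μ : ℂ) • 1) * proj Ωᶜ).IsHermitian := by
    have hH : (-(lap d L) - (μ : ℂ) • (1 : Matrix (Lam d L) (Lam d L) ℂ)).IsHermitian := by
      refine isHermitian_neg_lap.sub ?_
      simp [Matrix.IsHermitian, Matrix.conjTranspose_smul]
    have h := Matrix.isHermitian_mul_mul_conjTranspose (proj Ωᶜ) hH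
    rwa [proj_isHermitian] at h
  have h1 := negTrace_le hX hγ.1 hγ.2
  have h2 : 0 ≤ (proj Ω * (-(lap d L)) * proj Ω * γ).trace.re := by
    have h := (posSemidef_neg_lap (d := d) hL2).mul_mul_conjTranspose_same (proj Ω)
    rw [proj_isHermitian] at h
    exact trace_mul_re_nonneg h hγ.1
  have h3 : (((μ : ℂ) • proj Ω) * γ).trace.re
      = μ * ∑ x ∈ Finset.univ.filter (fun x => x ∈ Ω), (γ x x).re := by
    rw [Matrix.smul_mul, Matrix.trace_smul, smul_eq_mul, Complex.re_ofReal_mul, Matrix.trace,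
      Complex.re_sum, Finset.sum_filter]
    congr 1
    refine Finset.sum_congr rfl fun x _ => ?_
    rw [Matrix.diag_apply, proj, Matrix.diagonal_mul]
    split_ifs <;> simp
  have h4 := hopping_lower_bound hδ hγ hle
  have h5 : (((-(lap d L) - (μ : ℂ) • 1) * γ).trace).re
      = (proj Ωᶜ * (-(lap d L) - (μ : ℂ) • 1) * proj Ωᶜ * γ).trace.re
        + (proj Ω * (-(lap d L)) * proj Ω * γ).trace.re - (((μ : ℂ) • proj Ω) * γ).trace.re
        + ((proj Ω * (-(lap d L)) * proj Ωᶜ + proj Ωᶜ * (-(lap d L)) * proj Ω) * γ).trace.re := by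
    conv_lhs => rw [kinetic_block_decomposition (μ : ℂ) Ω]
    rw [Matrix.add_mul, Matrix.sub_mul, Matrix.add_mul, Matrix.trace_add, Matrix.trace_sub,
      Matrix.trace_add, Complex.add_re, Complex.sub_re, Complex.add_re]
  rw [h5, h3]
  linarith
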